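/- arXiv:2603.11790 — 4 statements merged into one kernel-verified Lean document; each statement's English description precedes it below -/
import Mathlib

section
/- Let G be a group acting on a set W, let E be the Euclidean space ℝ^d, let f : W → E, and let A : G → (E →L[ℝ] E) assign a continuous linear map to each group element. Let g, g', u ∈ G, m ∈ ℕ, and ε, r ≥ 0. Assume: (i) for every w ∈ W and each a ∈ {g, g', u}, ‖A(a)(f w) − f(a • w)‖ ≤ ε; (ii) the operator norm of A(u) is at most r; (iii) g = u^m * g'. Then for every w ∈ W, ‖A(g)(f w) − (A(u))^m (A(g')(f w))‖ ≤ ε · (1 + Σ_{i=0}^{m} r^i). -/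
/-- If `T` intertwines `f` with the action of `u` up to an error `ε` and `‖T‖ ≤ r`, then iterating
`T` from an `ε`-approximation of `f v` approximates `f (u ^ m • v)` up to `ε * ∑_{i=0}^{m} r ^ i`. -/
theorem norm_pow_apply_sub_pow_smul_le {𝕜 M W E : Type*} [NontriviallyNormedField 𝕜] [Monoid M]
    [MulAction M W] [SeminormedAddCommGroup E] [NormedSpace 𝕜 E] {f : W → E} {T : E →L[𝕜] E}
    {u : M} {ε r : ℝ} (hT : ∀ w, ‖T (f w) - f (u • w)‖ ≤ ε) (hr : ‖T‖ ≤ r)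
    {x : E} {v : W} (hx : ‖x - f v‖ ≤ ε) (m : ℕ) :
    ‖(T ^ m) x - f (u ^ m • v)‖ ≤ ε * ∑ i ∈ Finset.range (m + 1), r ^ i := by
  induction m with
  | zero => simpa using hx
  | succ m ih =>
    calc ‖(T ^ (m + 1)) x - f (u ^ (m + 1) • v)‖
        = ‖T ((T ^ m) x - f (u ^ m • v)) + (T (f (u ^ m • v)) - f (u • u ^ m • v))‖ := by
          rw [pow_succ', pow_succ', mul_smul, map_sub, sub_add_sub_cancel]
          rfl
      _ ≤ r * (ε * ∑ i ∈ Finset.range (m + 1), r ^ i) + ε :=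
          norm_add_le_of_le (T.le_of_opNorm_le_of_le hr ih) (hT _)
      _ = ε * ∑ i ∈ Finset.range (m + 1 + 1), r ^ i := by
          rw [geom_sum_succ (n := m + 1)]
          ring

open Finset in
/-- If the action loss of `g`, `g'`, `u` is at most `ε`, the operator norm of `A u` is at
most `r`, and `g = u ^ m * g'`, then `‖A g (f w) - (A u) ^ m (A g' (f w))‖` is at most
`ε * (1 + ∑_{i=0}^{m} r ^ i)` for every `w`. -/
theorem stmt_1 {G : Type*} [Group G] {W : Type*} [MulAction G W] {d : ℕ}
    (f : W → EuclideanSpace ℝ (Fin d))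
    (A : G → (EuclideanSpace ℝ (Fin d) →L[ℝ] EuclideanSpace ℝ (Fin d)))
    (g g' u : G) (m : ℕ) (ε r : ℝ) (hε : 0 ≤ ε) (hr : 0 ≤ r)
    (hloss : ∀ w : W, ∀ a ∈ ({g, g', u} : Set G), ‖A a (f w) - f (a • w)‖ ≤ ε)
    (hnorm : ‖A u‖ ≤ r)
    (hcomp : g = u ^ m * g') :
    ∀ w : W, ‖A g (f w) - ((A u) ^ m) (A g' (f w))‖ ≤
      ε * (1 + ∑ i ∈ Finset.range (m + 1), r ^ i) := by
  intro w
  have hg := hloss w g (by simp)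
  have hiter := norm_pow_apply_sub_pow_smul_le (fun w => hloss w u (by simp)) hnorm
    (hloss w g' (by simp)) m
  rw [← mul_smul, ← hcomp, norm_sub_rev] at hiter
  rw [mul_add, mul_one]
  exact (norm_sub_le_norm_sub_add_norm_sub _ (f (g • w)) _).trans (add_le_add hg hiter)
end

section
/- Let G be a group acting on a set W, let E be the Euclidean space ℝ^d, let f : W → E, and let A : G → (E →L[ℝ] E). Let g, g', u ∈ G, m ∈ ℕ, ε, r, δ ≥ 0, and fix w ∈ W. Assume: (i) for each a ∈ {g, g', u}, and every w' ∈ W, ‖A(a)(f w') − f(a • w')‖ ≤ ε; (ii) the operator norm of A(u) is at most r; (iii) δ ≤ ‖f(g • w) − f((u^m * g') • w)‖. Then ‖A(g)(f w) − (A(u))^m (A(g')(f w))‖ ≥ δ − ε · (1 + Σ_{i=0}^{m} r^i). -/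
/-- If `B` intertwines `f` with the action of `u` up to an error `ε` and `‖B‖ ≤ r`, then the error
accumulated after `m` iterations, starting from an `ε`-approximation `x` of `f v`, is at most
`ε * ∑ i ≤ m, r ^ i`. -/
theorem norm_pow_apply_sub_le_geom_sum {M W E : Type*} [Monoid M] [MulAction M W]
    [SeminormedAddCommGroup E] [NormedSpace ℝ E] {f : W → E} {B : E →L[ℝ] E} {u : M} {ε r : ℝ}
    (hB : ∀ w, ‖B (f w) - f (u • w)‖ ≤ ε) (hr : ‖B‖ ≤ r) {x : E} {v : W}
    (hx : ‖x - f v‖ ≤ ε) (m : ℕ) :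
    ‖(B ^ m) x - f (u ^ m • v)‖ ≤ ε * ∑ i ∈ Finset.range (m + 1), r ^ i := by
  induction m with
  | zero => simpa using hx
  | succ m ih =>
    have hstep : ‖B ((B ^ m) x - f (u ^ m • v))‖ ≤
        r * (ε * ∑ i ∈ Finset.range (m + 1), r ^ i) :=
      B.le_of_opNorm_le_of_le hr ih
    calc ‖(B ^ (m + 1)) x - f (u ^ (m + 1) • v)‖
        = ‖B ((B ^ m) x - f (u ^ m • v)) + (B (f (u ^ m • v)) - f (u • u ^ m • v))‖ := by
          rw [pow_succ' B, pow_succ' u, mul_smul, mul_apply_eq_comp, map_sub,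
            sub_add_sub_cancel]
      _ ≤ r * (ε * ∑ i ∈ Finset.range (m + 1), r ^ i) + ε :=
          norm_add_le_of_le hstep (hB _)
      _ = ε * ∑ i ∈ Finset.range (m + 1 + 1), r ^ i := by
          rw [geom_sum_succ (n := m + 1)]
          ring

open Finset in
/-- Separation inequality: if the encodings of `g • w` and `(u ^ m * g') • w` are at
distance at least `δ`, then `‖A g (f w) - (A u) ^ m (A g' (f w))‖ ≥ δ - ε (1 + ∑ r^i)`. -/
theorem stmt_2 {G : Type*} [Group G] {W : Type*} [MulAction G W] {d : ℕ}
    (f : W → EuclideanSpace ℝ (Fin d))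
    (A : G → (EuclideanSpace ℝ (Fin d) →L[ℝ] EuclideanSpace ℝ (Fin d)))
    (g g' u : G) (m : ℕ) (ε r δ : ℝ) (hε : 0 ≤ ε) (hr : 0 ≤ r) (hδ : 0 ≤ δ)
    (w : W)
    (hloss : ∀ a ∈ ({g, g', u} : Set G), ∀ w' : W, ‖A a (f w') - f (a • w')‖ ≤ ε)
    (hnorm : ‖A u‖ ≤ r)
    (hsep : δ ≤ ‖f (g • w) - f ((u ^ m * g') • w)‖) :
    δ - ε * (1 + ∑ i ∈ Finset.range (m + 1), r ^ i) ≤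
      ‖A g (f w) - ((A u) ^ m) (A g' (f w))‖ := by
  have hiter := norm_pow_apply_sub_le_geom_sum (hloss u (by simp)) hnorm
    (hloss g' (by simp) w) m
  rw [smul_smul] at hiter
  have hg := hloss g (by simp) w
  rw [norm_sub_rev] at hg
  have htri := norm_sub_le_norm_sub_add_norm_sub (f (g • w)) (A g (f w)) (f ((u ^ m * g') • w))
  have htri' := norm_sub_le_norm_sub_add_norm_sub (A g (f w)) ((A u ^ m) (A g' (f w)))
    (f ((u ^ m * g') • w))
  linarith
end

section
/- For every natural number n ≥ 5 and every natural number d, if there exists an injective group homomorphism from the symmetric group 𝔖ₙ on n letters into GL(d, ℝ), then d ≥ n − 1. -/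
open Module

/-- A family of endomorphisms indexed by pairs of points which satisfies the relations that hold
between the transpositions of a symmetric group, up to a common sign. -/
structure IsTranspositionSystem {α K V : Type*} [Field K] [AddCommGroup V] [Module K V]
    (T : α → α → End K V) : Prop where
  symm : ∀ x y, T x y = T y x
  sq : ∀ x y, x ≠ y → ∀ v, T x y (T x y v) = v
  braid : ∀ x y z, x ≠ y → x ≠ z → y ≠ z → ∀ v, T x y (T x z v) = T y z (T x y v)
  comm : ∀ x y z w, x ≠ y → z ≠ w → x ≠ z → x ≠ w → y ≠ z → y ≠ w →
    ∀ v, T x y (T z w v) = T z w (T x y v)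

/-- A nonzero vector which is negated by the transposition of `a` and `b` and fixed by the
transpositions of the points of `S` other than `a` and `b`. -/
structure IsAlternatingPairVector {α K V : Type*} [Field K] [AddCommGroup V] [Module K V]
    (T : α → α → End K V) (S : Finset α) (a b : α) (v : V) : Prop where
  left_mem : a ∈ S
  right_mem : b ∈ S
  ne : a ≠ b
  ne_zero : v ≠ 0
  map_eq_neg : T a b v = -v
  map_eq_self : ∀ c ∈ S, ∀ d ∈ S, c ≠ a → c ≠ b → d ≠ a → d ≠ b → c ≠ d → T c d v = v

section Predicates

variable {α K V : Type*} [Field K] [AddCommGroup V] [Module K V]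

/-- `W` is stable under the transpositions of the points of `S`. -/
def IsPairStable (T : α → α → End K V) (S : Finset α) (W : Submodule K V) : Prop :=
  ∀ x ∈ S, ∀ y ∈ S, x ≠ y → ∀ w ∈ W, T x y w ∈ W

/-- Transpositions in `S` with a common point agree on `W`. -/
def EqOnAdjacent (T : α → α → End K V) (S : Finset α) (W : Submodule K V) : Prop :=
  ∀ x ∈ S, ∀ y ∈ S, ∀ z ∈ S, x ≠ y → x ≠ z → y ≠ z → ∀ w ∈ W, T x y w = T x z w

/-- Disjoint transpositions in `S` agree on `W`. -/
def EqOnDisjoint (T : α → α → End K V) (S : Finset α) (W : Submodule K V) : Prop :=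
  ∀ a ∈ S, ∀ b ∈ S, ∀ c ∈ S, ∀ d ∈ S, a ≠ b → c ≠ d → c ≠ a → c ≠ b → d ≠ a → d ≠ b →
    ∀ w ∈ W, T a b w = T c d w

/-- The vectors of `W` negated by the transposition of `a` and `b`. -/
def antiPart (T : α → α → End K V) (W : Submodule K V) (a b : α) : Submodule K V :=
  W ⊓ LinearMap.ker (T a b + 1)

theorem mem_antiPart {T : α → α → End K V} {W : Submodule K V} {a b : α} {v : V} :
    v ∈ antiPart T W a b ↔ v ∈ W ∧ T a b v = -v := by
  simp [antiPart, eq_neg_iff_add_eq_zero]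

theorem mem_antiPart_neg {T : α → α → End K V} {W : Submodule K V} {a b : α} {v : V} :
    v ∈ antiPart (fun x y ↦ -T x y) W a b ↔ v ∈ W ∧ T a b v = v := by
  simp [mem_antiPart]

end Predicates

section LinearAlgebra

variable {ι K V : Type*} [Field K] [AddCommGroup V] [Module K V] {s : Finset ι} {u : ι → V}
  {W : Submodule K V}

theorem LinearIndepOn.finrank_span_image_finset (h : LinearIndepOn K u (s : Set ι)) :
    finrank K (Submodule.span K (u '' s)) = s.card := by
  have := finrank_span_eq_card (R := K) (b := fun i : s ↦ u i) h
  rw [Fintype.card_coe] at this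
  rw [← this]
  have h' : u '' (s : Set ι) = Set.range fun i : s ↦ u i := by ext x; simp
  rw [h']

theorem LinearIndepOn.card_le_finrank_of_mem [FiniteDimensional K V]
    (h : LinearIndepOn K u (s : Set ι)) (hu : ∀ i ∈ s, u i ∈ W) : s.card ≤ finrank K W := by
  rw [← h.finrank_span_image_finset]
  apply Submodule.finrank_mono
  rw [Submodule.span_le]
  rintro _ ⟨i, hi, rfl⟩
  exact hu i hi

variable (K) in
theorem eq_zero_of_eq_neg [CharZero K] {v : V} (h : v = -v) : v = 0 := by
  have : (2 : K) • v = 0 := by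
    rw [two_smul]
    nth_rewrite 1 [h]
    exact neg_add_cancel v
  exact (smul_eq_zero.1 this).resolve_left two_ne_zero

end LinearAlgebra

namespace IsTranspositionSystem

variable {α K V : Type*} [Field K] [AddCommGroup V] [Module K V]
  {T : α → α → End K V} {S : Finset α} {W : Submodule K V} {a b : α} {v : V}

theorem neg (hT : IsTranspositionSystem T) : IsTranspositionSystem fun x y ↦ -T x y where
  symm x y := by rw [hT.symm]
  sq x y h v := by simp [hT.sq x y h]
  braid x y z h₁ h₂ h₃ v := by simp [hT.braid x y z h₁ h₂ h₃]
  comm x y z w h₁ h₂ h₃ h₄ h₅ h₆ v := by simp [hT.comm x y z w h₁ h₂ h₃ h₄ h₅ h₆]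

section Star

variable [DecidableEq α]

/-- The translate of `v` under the transposition of `b` and `j`. -/
def star (T : α → α → End K V) (b : α) (v : V) (j : α) : V := if j = b then v else T b j v

theorem star_self : star T b v b = v := if_pos rfl

theorem star_of_ne {j : α} (h : j ≠ b) : star T b v j = T b j v := if_neg h

theorem map_star_left (hT : IsTranspositionSystem T) (hv : IsAlternatingPairVector T S a b v)
    {j k : α} (hj : j ∈ S.erase a) (hk : k ∈ S.erase a) (hjk : j ≠ k) :
    T j k (star T b v j) = star T b v k := by
  rw [Finset.mem_erase] at hj hk
  by_cases hjb : j = b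
  · subst hjb
    rw [star_self, star_of_ne hjk.symm]
  by_cases hkb : k = b
  · subst hkb
    rw [star_self, star_of_ne hjk, hT.symm, hT.sq _ _ hjk.symm]
  rw [star_of_ne hjb, star_of_ne hkb, hT.symm b j, hT.braid j k b hjk hjb hkb,
    hv.map_eq_self j hj.2 k hk.2 hj.1 hjb hk.1 hkb hjk, hT.symm]

theorem map_star_right (hT : IsTranspositionSystem T) (hv : IsAlternatingPairVector T S a b v)
    {j k : α} (hj : j ∈ S.erase a) (hk : k ∈ S.erase a) (hjk : j ≠ k) :
    T j k (star T b v k) = star T b v j := by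
  rw [hT.symm, map_star_left hT hv hk hj hjk.symm]

theorem map_star_of_ne (hT : IsTranspositionSystem T) (hv : IsAlternatingPairVector T S a b v)
    {j k l : α} (hj : j ∈ S.erase a) (hk : k ∈ S.erase a) (hl : l ∈ S.erase a) (hjk : j ≠ k)
    (hlj : l ≠ j) (hlk : l ≠ k) : T j k (star T b v l) = star T b v l := by
  rw [Finset.mem_erase] at hj hk hl
  by_cases hlb : l = b
  · subst hlb
    rw [star_self, hv.map_eq_self j hj.2 k hk.2 hj.1 hlj.symm hk.1 hlk.symm hjk]
  rw [star_of_ne hlb]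
  by_cases hjb : j = b
  · subst hjb
    rw [hT.symm j l, ← hT.braid l j k hlj hlk hjk,
      hv.map_eq_self l hl.2 k hk.2 hl.1 hlb hk.1 hjk.symm hlk]
  by_cases hkb : k = b
  · subst hkb
    rw [hT.symm k l, hT.symm j k, ← hT.braid l k j hlk hlj hjk.symm,
      hv.map_eq_self l hl.2 j hj.2 hl.1 hlb hj.1 hjk hlj]
  rw [hT.comm j k b l hjk (Ne.symm hlb) hjb hlj.symm hkb hlk.symm,
    hv.map_eq_self j hj.2 k hk.2 hj.1 hjb hk.1 hkb hjk]

theorem map_sum_star (hT : IsTranspositionSystem T) (hv : IsAlternatingPairVector T S a b v)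
    (c : α → K) {j k : α} (hj : j ∈ S.erase a) (hk : k ∈ S.erase a) (hjk : j ≠ k) :
    T j k (∑ l ∈ S.erase a, c l • star T b v l) =
      ∑ l ∈ S.erase a, c l • star T b v l + (c j - c k) • (star T b v k - star T b v j) := by
  rw [← sub_eq_iff_eq_add', map_sum, ← Finset.sum_sub_distrib,
    Finset.sum_eq_add j k hjk _ (fun h ↦ absurd hj h) (fun h ↦ absurd hk h)]
  · rw [map_smul, map_smul, map_star_left hT hv hj hk hjk, map_star_right hT hv hj hk hjk]
    module
  · rintro l hl ⟨hlj, hlk⟩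
    rw [map_smul, map_star_of_ne hT hv hj hk hl hjk hlj hlk, sub_self]

theorem star_ne_left [CharZero K] (hT : IsTranspositionSystem T)
    (hv : IsAlternatingPairVector T S a b v) {k : α} (hk : k ∈ S.erase a) (hkb : k ≠ b) :
    star T b v k ≠ v := by
  rw [star_of_ne hkb]
  intro h
  rw [Finset.mem_erase] at hk
  have h₁ := hT.braid b a k hv.ne.symm hkb.symm hk.1.symm v
  rw [h, hT.symm b a, hv.map_eq_neg, map_neg, neg_inj] at h₁
  have h₂ := hT.braid k b a hkb hk.1 hv.ne.symm v
  rw [hT.symm k b, h, hT.symm k a, ← h₁, h, hT.symm b a, hv.map_eq_neg] at h₂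
  exact hv.ne_zero (eq_zero_of_eq_neg K h₂)

theorem star_ne [CharZero K] (hT : IsTranspositionSystem T)
    (hv : IsAlternatingPairVector T S a b v) {j k : α} (hj : j ∈ S.erase a) (hk : k ∈ S.erase a)
    (hjk : j ≠ k) : star T b v j ≠ star T b v k := by
  intro h
  have hb : b ∈ S.erase a := Finset.mem_erase.2 ⟨hv.ne.symm, hv.right_mem⟩
  by_cases hjb : j = b
  · subst hjb
    exact star_ne_left hT hv hk hjk.symm (h.symm.trans star_self)
  by_cases hkb : k = b
  · subst hkb
    exact star_ne_left hT hv hj hjk (h.trans star_self)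
  have := congrArg (T b j) h
  rw [map_star_right hT hv hb hj (Ne.symm hjb), map_star_of_ne hT hv hb hj hk (Ne.symm hjb) hkb
    hjk.symm, star_self] at this
  exact star_ne_left hT hv hk hkb this.symm

theorem coeff_eq [CharZero K] (hT : IsTranspositionSystem T)
    (hv : IsAlternatingPairVector T S a b v) {c : α → K}
    (hc : ∑ l ∈ S.erase a, c l • star T b v l = 0) {j k : α} (hj : j ∈ S.erase a)
    (hk : k ∈ S.erase a) : c j = c k := by
  by_cases hjk : j = k
  · rw [hjk]
  have h := map_sum_star hT hv c hj hk hjk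
  rw [hc, map_zero, zero_add] at h
  rcases smul_eq_zero.1 h.symm with h | h
  · exact sub_eq_zero.1 h
  · exact absurd (sub_eq_zero.1 h).symm (star_ne hT hv hj hk hjk)

theorem linearIndepOn_star [CharZero K] (hT : IsTranspositionSystem T)
    (hv : IsAlternatingPairVector T S a b v) (h : ∑ l ∈ S.erase a, star T b v l ≠ 0) :
    LinearIndepOn K (star T b v) (S.erase a : Finset α) := by
  rw [linearIndepOn_finset_iff]
  intro c hc j hj
  have h₁ : c j • ∑ l ∈ S.erase a, star T b v l = 0 := by
    rw [Finset.smul_sum, ← hc]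
    exact Finset.sum_congr rfl fun l hl ↦ by rw [coeff_eq hT hv hc hj hl]
  exact (smul_eq_zero.1 h₁).resolve_right h

theorem linearIndepOn_star_erase [CharZero K] (hT : IsTranspositionSystem T)
    (hv : IsAlternatingPairVector T S a b v) :
    LinearIndepOn K (star T b v) ((S.erase a).erase b : Finset α) := by
  rw [linearIndepOn_finset_iff]
  intro c hc j hj
  have hb : b ∈ S.erase a := Finset.mem_erase.2 ⟨hv.ne.symm, hv.right_mem⟩
  have h : ∑ l ∈ S.erase a, (if l = b then 0 else c l) • star T b v l = 0 := by
    rw [← Finset.sum_erase_add _ _ hb, if_pos rfl, zero_smul, add_zero, ← hc]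
    exact Finset.sum_congr rfl fun l hl ↦ by rw [if_neg (Finset.ne_of_mem_erase hl)]
  have := coeff_eq hT hv h (Finset.mem_of_mem_erase hj) hb
  rwa [if_neg (Finset.ne_of_mem_erase hj), if_pos rfl] at this

theorem sum_star_ne_zero [CharZero K] (hT : IsTranspositionSystem T)
    (hv : IsAlternatingPairVector T S a b v)
    (h : ∀ j ∈ S.erase a, j ≠ b → T a j v = v - star T b v j) :
    ∑ l ∈ S.erase a, star T b v l ≠ 0 := by
  intro h₀
  have hb : b ∈ S.erase a := Finset.mem_erase.2 ⟨hv.ne.symm, hv.right_mem⟩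
  have key : ∀ j ∈ S.erase a,
      T a b (star T b v j) = star T b v j - v - if j = b then v else 0 := by
    intro j hj
    by_cases hjb : j = b
    · rw [hjb, star_self, if_pos rfl, hv.map_eq_neg]
      abel
    · rw [if_neg hjb, sub_zero, ← neg_sub, ← h j hj hjb, star_of_ne hjb, hT.symm a b,
        hT.braid b a j hv.ne.symm (Ne.symm hjb) (Finset.ne_of_mem_erase hj).symm, hT.symm b a,
        hv.map_eq_neg, map_neg]
  have h₁ := congrArg (T a b) h₀
  rw [map_zero, map_sum, Finset.sum_congr rfl key, Finset.sum_sub_distrib,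
    Finset.sum_sub_distrib, h₀, Finset.sum_const, Finset.sum_ite_eq' _ b, if_pos hb] at h₁
  have h₂ : (((S.erase a).card + 1 : ℕ) : K) • v = 0 := by
    rw [Nat.cast_smul_eq_nsmul, add_smul, one_smul, ← neg_eq_zero, ← h₁]
    abel
  rcases smul_eq_zero.1 h₂ with h | h
  · exact Nat.cast_add_one_ne_zero _ ((Nat.cast_succ _).symm.trans h)
  · exact hv.ne_zero h

theorem map_eq_smul_sub_of_span [CharZero K] (hT : IsTranspositionSystem T)
    (hv : IsAlternatingPairVector T S a b v) {c : α} (hc : c ∈ S.erase a) (hcb : c ≠ b)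
    (h : T a c v ∈ Submodule.span K (star T b v '' (S.erase a : Finset α))) :
    ∃ x : K, ∀ e ∈ S.erase a, e ≠ b → T a e v = x • (v - star T b v e) := by
  have hb : b ∈ S.erase a := Finset.mem_erase.2 ⟨hv.ne.symm, hv.right_mem⟩
  obtain ⟨y, hy⟩ := (Submodule.mem_span_image_finset_iff_exists_fun K).1 h
  obtain ⟨z, hz⟩ : ∃ z : α → K, ∀ i : (S.erase a : Finset α), y i = z i :=
    ⟨fun i ↦ if hi : i ∈ S.erase a then y ⟨i, hi⟩ else 0, fun ⟨i, hi⟩ ↦ by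
      simp only [dif_pos hi]⟩
  simp only [hz] at hy
  rw [Finset.sum_coe_sort (S.erase a) fun i ↦ z i • star T b v i] at hy
  have h₁ := map_sum_star hT hv z hb hc hcb.symm
  have hca := Finset.ne_of_mem_erase hc
  rw [hy, star_self] at h₁
  have h₂ : T b c (T a c v) = -T a c v := by
    rw [hT.symm b c, ← hT.braid a c b hca.symm hv.ne hcb, hv.map_eq_neg, map_neg]
  rw [h₂] at h₁
  have h₃ : T a c v = ((z b - z c) / 2) • (v - star T b v c) := by
    have : (2 : K) • T a c v = (z b - z c) • (v - star T b v c) := by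
      rw [two_smul, ← sub_eq_zero, ← sub_eq_zero.2 h₁.symm]
      module
    rw [div_eq_inv_mul, mul_smul, ← this, smul_smul, inv_mul_cancel₀ two_ne_zero, one_smul]
  refine ⟨(z b - z c) / 2, fun e he heb ↦ ?_⟩
  by_cases hec : e = c
  · rw [hec, h₃]
  have hea := Finset.ne_of_mem_erase he
  have hce : T c e v = v := hv.map_eq_self c (Finset.mem_of_mem_erase hc) e
    (Finset.mem_of_mem_erase he) hca hcb hea heb (Ne.symm hec)
  have h₄ := congrArg (T c e) h₃
  rw [map_smul, map_sub, map_star_left hT hv hc he (Ne.symm hec), hce] at h₄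
  rw [← h₄, hT.symm a c, hT.braid c e a (Ne.symm hec) hca hea, hce, hT.symm]

theorem map_eq_sub_star [CharZero K] (hT : IsTranspositionSystem T)
    (hv : IsAlternatingPairVector T S a b v) {x : K}
    (h : ∀ e ∈ S.erase a, e ≠ b → T a e v = x • (v - star T b v e)) {c e : α}
    (hc : c ∈ S.erase a) (hcb : c ≠ b) (he : e ∈ S.erase a) (heb : e ≠ b) (hce : c ≠ e) :
    x = 1 := by
  have hb : b ∈ S.erase a := Finset.mem_erase.2 ⟨hv.ne.symm, hv.right_mem⟩
  have hca := Finset.ne_of_mem_erase hc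
  have hea := Finset.ne_of_mem_erase he
  have hcev : T c e v = v := hv.map_eq_self c (Finset.mem_of_mem_erase hc) e
    (Finset.mem_of_mem_erase he) hca hcb hea heb hce
  have h₁ := congrArg (T b e) (h c hc hcb)
  rw [map_smul, map_sub, map_star_of_ne hT hv hb he hc heb.symm hcb hce, 
    hT.comm b e a c heb.symm hca.symm hv.ne.symm hcb.symm hea hce.symm, ← star_of_ne heb] at h₁
  have h₂ : T a c (v - star T b v e) = T a e v := by
    rw [map_sub, h₁, h c hc hcb, h e he heb]
    module
  have h₃ := congrArg (T a c) h₂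
  rw [hT.sq _ _ hca.symm, hT.braid a c e hca.symm hea.symm hce, h c hc hcb, map_smul, map_sub,
    map_star_left hT hv hc he hce, hcev] at h₃
  have h₄ : (x - 1) • (v - star T b v e) = 0 := by rw [sub_smul, one_smul, ← h₃, sub_self]
  rcases smul_eq_zero.1 h₄ with h₄ | h₄
  · exact sub_eq_zero.1 h₄
  · exact absurd (sub_eq_zero.1 h₄).symm (star_ne_left hT hv he heb)

theorem star_mem (hW : IsPairStable T S W)
    (hv : IsAlternatingPairVector T S a b v) (hvW : v ∈ W) {j : α} (hj : j ∈ S) :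
    star T b v j ∈ W := by
  by_cases hjb : j = b
  · rwa [hjb, star_self]
  · rw [star_of_ne hjb]
    exact hW b hv.right_mem j hj (Ne.symm hjb) v hvW

/-- A stable subspace which contains an alternating pair vector for at least four points has
dimension at least the number of points minus one. -/
theorem card_le_finrank_add_one_of_isAlternatingPairVector [CharZero K] [FiniteDimensional K V]
    (hT : IsTranspositionSystem T) (hW : IsPairStable T S W)
    (hS : 4 ≤ S.card) (hv : IsAlternatingPairVector T S a b v) (hvW : v ∈ W) :
    S.card ≤ finrank K W + 1 := by
  have hb : b ∈ S.erase a := Finset.mem_erase.2 ⟨hv.ne.symm, hv.right_mem⟩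
  have hca := Finset.card_erase_of_mem hv.left_mem
  have hcb := Finset.card_erase_of_mem hb
  by_cases h₀ : ∑ l ∈ S.erase a, star T b v l = 0
  swap
  · have := (linearIndepOn_star hT hv h₀).card_le_finrank_of_mem
      fun i hi ↦ star_mem hW hv hvW (Finset.mem_of_mem_erase hi)
    omega
  by_contra! hlt
  have hspan : Submodule.span K (star T b v '' ((S.erase a).erase b : Finset α)) = W := by
    apply Submodule.eq_of_le_of_finrank_le
    · rw [Submodule.span_le]
      rintro _ ⟨i, hi, rfl⟩
      exact star_mem hW hv hvW (Finset.mem_of_mem_erase (Finset.mem_of_mem_erase hi))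
    · rw [(linearIndepOn_star_erase hT hv).finrank_span_image_finset]
      omega
  obtain ⟨c, hc, e, he, hce⟩ := Finset.one_lt_card.1
    (show 1 < ((S.erase a).erase b).card by omega)
  rw [Finset.mem_erase] at hc he
  have hac : T a c v ∈ Submodule.span K (star T b v '' (S.erase a : Finset α)) := by
    refine Submodule.span_mono (Set.image_mono (Finset.coe_subset.2 (Finset.erase_subset b _))) ?_
    rw [hspan]
    exact hW a hv.left_mem c (Finset.mem_of_mem_erase hc.2)
      (Finset.ne_of_mem_erase hc.2).symm v hvW
  obtain ⟨x, hx⟩ := map_eq_smul_sub_of_span hT hv hc.2 hc.1 hac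
  have hx₁ := map_eq_sub_star hT hv hx hc.2 hc.1 he.2 he.1 hce
  refine sum_star_ne_zero hT hv (fun j hj hjb ↦ ?_) h₀
  rw [hx j hj hjb, hx₁, one_smul]

end Star

theorem eqOn_pairs_of_eqOnAdjacent (hT : IsTranspositionSystem T) (h : EqOnAdjacent T S W)
    {x y z w : α} (hx : x ∈ S) (hy : y ∈ S) (hz : z ∈ S) (hw : w ∈ S) (hxy : x ≠ y)
    (hzw : z ≠ w) {v : V} (hv : v ∈ W) : T x y v = T z w v := by
  have h' : ∀ x ∈ S, ∀ y ∈ S, ∀ z ∈ S, x ≠ y → x ≠ z → T x y v = T x z v := by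
    intro x hx y hy z hz hxy hxz
    by_cases hyz : y = z
    · rw [hyz]
    · exact h x hx y hy z hz hxy hxz hyz v hv
  by_cases hxw : x = w
  · subst hxw
    rw [hT.symm z x]
    exact h' x hx y hy z hz hxy hzw.symm
  · rw [h' x hx y hy w hw hxy hxw, hT.symm x w, hT.symm z w]
    exact h' w hw x hx z hz (Ne.symm hxw) hzw.symm

theorem eqOnAdjacent_of_eqOnDisjoint [DecidableEq α] (hS : 5 ≤ S.card)
    (h : EqOnDisjoint T S W) : EqOnAdjacent T S W := by
  intro x hx y hy z hz hxy hxz hyz w hw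
  have hcard : 1 < (((S.erase x).erase y).erase z).card := by
    rw [Finset.card_erase_of_mem, Finset.card_erase_of_mem, Finset.card_erase_of_mem hx]
    · omega
    all_goals simp [*, Ne.symm hxy, Ne.symm hxz, Ne.symm hyz]
  obtain ⟨p, hp, q, hq, hpq⟩ := Finset.one_lt_card.1 hcard
  simp only [Finset.mem_erase] at hp hq
  rw [h x hx y hy p hp.2.2.2 q hq.2.2.2 hxy hpq hp.2.2.1 hp.2.1 hq.2.2.1 hq.2.1 w hw,
    h x hx z hz p hp.2.2.2 q hq.2.2.2 hxz hpq hp.2.2.1 hp.1 hq.2.2.1 hq.1 w hw]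

theorem three_le_card_of_not_eqOnAdjacent [DecidableEq α] (h : ¬ EqOnAdjacent T S W) :
    3 ≤ S.card := by
  contrapose! h
  intro x hx y hy z hz hxy hxz hyz
  have : ({x, y, z} : Finset α).card ≤ S.card := by
    apply Finset.card_le_card
    simp [Finset.insert_subset_iff, hx, hy, hz]
  rw [Finset.card_eq_three.2 ⟨x, y, z, hxy, hxz, hyz, rfl⟩] at this
  omega

theorem two_le_finrank_of_not_eqOnAdjacent [FiniteDimensional K V]
    (hT : IsTranspositionSystem T) (hW : IsPairStable T S W) (h : ¬ EqOnAdjacent T S W) :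
    2 ≤ finrank K W := by
  contrapose! h
  intro x hx y hy z hz hxy hxz hyz w hw
  obtain ⟨u, hu⟩ := finrank_le_one_iff.1 (Nat.le_of_lt_succ h)
  have scalar : ∀ p ∈ S, ∀ q ∈ S, p ≠ q → ∃ c : K, ∀ t ∈ W, T p q t = c • t := by
    intro p hp q hq hpq
    obtain ⟨c, hc⟩ := hu ⟨T p q u, hW p hp q hq hpq u u.2⟩
    refine ⟨c, fun t ht ↦ ?_⟩
    obtain ⟨e, he⟩ := hu ⟨t, ht⟩
    rw [Subtype.ext_iff] at hc he
    simp only [Submodule.coe_smul] at hc he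
    rw [← he, map_smul, ← hc, smul_comm]
  obtain ⟨c, hc⟩ := scalar x hx y hy hxy
  obtain ⟨d, hd⟩ := scalar x hx z hz hxz
  obtain ⟨e, he⟩ := scalar y hy z hz hyz
  rcases eq_or_ne w 0 with rfl | hw₀
  · rw [map_zero, map_zero]
  have inj := smul_left_injective K hw₀
  have h₁ := hT.braid x y z hxy hxz hyz w
  have h₂ := hT.sq x y hxy w
  have h₃ := hT.braid x z y hxz hxy hyz.symm w
  have h₄ := hT.sq x z hxz w
  rw [hT.symm z y] at h₃
  simp only [hc w hw, hd w hw, he w hw, map_smul, smul_smul] at h₁ h₂ h₃ h₄ ⊢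
  have hc₀ : c ≠ 0 := by
    rintro rfl
    rw [mul_zero, zero_smul] at h₂
    exact hw₀ h₂.symm
  have hd₀ : d ≠ 0 := by
    rintro rfl
    rw [mul_zero, zero_smul] at h₄
    exact hw₀ h₄.symm
  have h₅ : d * c = c * e := inj h₁
  have h₆ : c * d = d * e := inj h₃
  rw [mul_left_cancel₀ hc₀ ((mul_comm c d).trans h₅),
    mul_left_cancel₀ hd₀ ((mul_comm d c).trans h₆)]

theorem isPairStable_antiPart [DecidableEq α] (hT : IsTranspositionSystem T)
    (hW : IsPairStable T S W) (hab : a ≠ b) :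
    IsPairStable T ((S.erase a).erase b) (antiPart T W a b) := by
  intro x hx y hy hxy w hw
  simp only [Finset.mem_erase] at hx hy
  rw [mem_antiPart] at hw ⊢
  refine ⟨hW x hx.2.2 y hy.2.2 hxy w hw.1, ?_⟩
  rw [hT.comm a b x y hab hxy (Ne.symm hx.2.1) (Ne.symm hy.2.1) (Ne.symm hx.1) (Ne.symm hy.1),
    hw.2, map_neg]

theorem isPairStable_neg (hW : IsPairStable T S W) : IsPairStable (fun x y ↦ -T x y) S W :=
  fun x hx y hy hxy w hw ↦ W.neg_mem (hW x hx y hy hxy w hw)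

theorem eqOnAdjacent_neg_iff : EqOnAdjacent (fun x y ↦ -T x y) S W ↔ EqOnAdjacent T S W := by
  simp [EqOnAdjacent]

theorem finrank_antiPart_add_le [CharZero K] [FiniteDimensional K V] :
    finrank K (antiPart T W a b) + finrank K (antiPart (fun x y ↦ -T x y) W a b) ≤
      finrank K W := by
  have hdisj : antiPart T W a b ⊓ antiPart (fun x y ↦ -T x y) W a b = ⊥ := by
    rw [eq_bot_iff]
    rintro v ⟨h₁, h₂⟩
    exact eq_zero_of_eq_neg K ((mem_antiPart_neg.1 h₂).2.symm.trans (mem_antiPart.1 h₁).2)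
  have := Submodule.finrank_sup_add_finrank_inf_eq (antiPart T W a b)
    (antiPart (fun x y ↦ -T x y) W a b)
  rw [hdisj, finrank_bot, add_zero] at this
  rw [← this]
  exact Submodule.finrank_mono (sup_le inf_le_left inf_le_left)

theorem eqOn_of_eqOn_antiPart [CharZero K] (hT : IsTranspositionSystem T)
    (hW : IsPairStable T S W) (ha : a ∈ S) (hb : b ∈ S) (hab : a ≠ b) {f g : End K V}
    (h₁ : ∀ v ∈ antiPart T W a b, f v = g v)
    (h₂ : ∀ v ∈ antiPart (fun x y ↦ -T x y) W a b, f v = g v) {w : V} (hw : w ∈ W) :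
    f w = g w := by
  have hTw := hW a ha b hb hab w hw
  have k₁ := h₁ (w - T a b w) (mem_antiPart.2 ⟨W.sub_mem hw hTw, by
    rw [map_sub, hT.sq a b hab, neg_sub]⟩)
  have k₂ := h₂ (w + T a b w) (mem_antiPart_neg.2 ⟨W.add_mem hw hTw, by
    rw [map_add, hT.sq a b hab, add_comm]⟩)
  rw [map_sub, map_sub] at k₁
  rw [map_add, map_add] at k₂
  have : (2 : K) • (f w - g w) = 0 := by
    rw [← sub_eq_zero] at k₁ k₂
    rw [← add_zero (0 : V)]
    nth_rewrite 1 [← k₁]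
    rw [← k₂]
    module
  exact sub_eq_zero.1 ((smul_eq_zero.1 this).resolve_left two_ne_zero)

theorem eqOn_of_map_eq_neg [CharZero K] (hT : IsTranspositionSystem T)
    (hW : IsPairStable T S W) {c d : α} (ha : a ∈ S) (hb : b ∈ S) (hc : c ∈ S) (hd : d ∈ S)
    (hab : a ≠ b) (hcd : c ≠ d) (hca : c ≠ a) (hcb : c ≠ b) (hda : d ≠ a) (hdb : d ≠ b)
    (h : ∀ v ∈ W, T a b v = -v → T c d v = -v) {w : V} (hw : w ∈ W) : T a b w = T c d w := by
  have hconj : ∀ u, T a b (T a c (T b d u)) = T a c (T b d (T c d u)) := by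
    intro u
    rw [hT.symm b d, hT.symm c d, hT.braid d b c hdb hcd.symm hcb.symm, hT.symm a c,
      hT.symm b c, hT.braid c a b hca hcb hab]
  have hmem : ∀ u ∈ W, T a c (T b d u) ∈ W := fun u hu ↦
    hW a ha c hc hca.symm _ (hW b hb d hd hdb.symm u hu)
  have h' : ∀ v ∈ W, T c d v = -v → T a b v = -v := by
    intro v hv hv'
    have hsq : ∀ u, T a c (T b d (T a c (T b d u))) = u := by
      intro u
      rw [hT.comm b d a c hdb.symm hca.symm hab.symm hcb.symm hda hcd.symm, hT.sq a c hca.symm,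
        hT.sq b d hdb.symm]
    have h₁ := hconj v
    rw [hv', map_neg, map_neg] at h₁
    have h₂ := hconj (T a c (T b d v))
    rwa [h _ (hmem v hv) h₁, map_neg, map_neg, hsq] at h₂
  refine eqOn_of_eqOn_antiPart hT hW ha hb hab (fun v hv ↦ ?_) (fun v hv ↦ ?_) hw
  · rw [mem_antiPart] at hv
    rw [hv.2, h v hv.1 hv.2]
  · rw [mem_antiPart_neg] at hv
    have hm := hW c hc d hd hcd v hv.1
    have h₁ := h' (v - T c d v) (W.sub_mem hv.1 hm) (by rw [map_sub, hT.sq c d hcd, neg_sub])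
    rw [map_sub, hT.comm a b c d hab hcd hca.symm hda.symm hcb.symm hdb.symm, hv.2] at h₁
    rw [hv.2]
    exact sub_eq_zero.1 (eq_zero_of_eq_neg K h₁)

/-- If the transpositions disjoint from `a` and `b` act on the vectors negated by the transposition
of `a` and `b` through a common involution, then either the dimension is large or they agree with
the latter. -/
theorem eqOn_of_eqOnAdjacent_antiPart [DecidableEq α] [CharZero K] [FiniteDimensional K V]
    (hT : IsTranspositionSystem T) (hW : IsPairStable T S W) (hS : 4 ≤ S.card)
    (hlt : finrank K W + 1 < S.card) {c d : α} (ha : a ∈ S) (hb : b ∈ S) (hc : c ∈ S)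
    (hd : d ∈ S) (hab : a ≠ b) (hcd : c ≠ d) (hca : c ≠ a) (hcb : c ≠ b) (hda : d ≠ a)
    (hdb : d ≠ b) (h : EqOnAdjacent T ((S.erase a).erase b) (antiPart T W a b)) {w : V}
    (hw : w ∈ W) : T a b w = T c d w := by
  have hmem : ∀ {x}, x ∈ S → x ≠ a → x ≠ b → x ∈ (S.erase a).erase b := fun hx hxa hxb ↦
    Finset.mem_erase.2 ⟨hxb, Finset.mem_erase.2 ⟨hxa, hx⟩⟩
  refine eqOn_of_map_eq_neg hT hW ha hb hc hd hab hcd hca hcb hda hdb (fun v hv hv' ↦ ?_) hw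
  by_contra hne
  have hstable := isPairStable_antiPart hT hW hab
  have hu : v + T c d v ∈ antiPart T W a b :=
    Submodule.add_mem _ (mem_antiPart.2 ⟨hv, hv'⟩)
      (hstable c (hmem hc hca hcb) d (hmem hd hda hdb) hcd v (mem_antiPart.2 ⟨hv, hv'⟩))
  refine hlt.not_ge (card_le_finrank_add_one_of_isAlternatingPairVector hT hW hS
    (a := a) (b := b) ⟨ha, hb, hab, fun h₀ ↦ hne (eq_neg_of_add_eq_zero_right h₀),
      (mem_antiPart.1 hu).2, fun e he f hf hea heb hfa hfb hef ↦ ?_⟩ (mem_antiPart.1 hu).1)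
  rw [eqOn_pairs_of_eqOnAdjacent hT h (hmem he hea heb) (hmem hf hfa hfb) (hmem hc hca hcb)
    (hmem hd hda hdb) hef hcd hu, map_add, hT.sq c d hcd, add_comm]

theorem eqOn_of_eqOn_disjoint (hT : IsTranspositionSystem T) (hW : IsPairStable T S W)
    {c d e f : α} (ha : a ∈ S) (hb : b ∈ S) (he : e ∈ S) (hf : f ∈ S)
    (hab : a ≠ b) (hcd : c ≠ d) (hef : e ≠ f) (hca : c ≠ a) (hcb : c ≠ b) (hda : d ≠ a)
    (hdb : d ≠ b) (hea : e ≠ a) (hfa : f ≠ a) (hfb : f ≠ b) (hec : e ≠ c)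
    (hed : e ≠ d) (hfc : f ≠ c) (hfd : f ≠ d) (h : ∀ w ∈ W, T c d w = T e f w) {w : V}
    (hw : w ∈ W) : T a b w = T c d w := by
  have h₁ := h (T a e (T b f w)) (hW a ha e he hea.symm _ (hW b hb f hf hfb.symm w hw))
  rw [hT.comm c d a e hcd hea.symm hca hec.symm hda hed.symm,
    hT.comm c d b f hcd hfb.symm hcb hfc.symm hdb hfd.symm,
    ← hT.braid a e f hea.symm hfa.symm hef, hT.symm a f,
    ← hT.braid b f a hfb.symm hab.symm hfa, hT.symm b a] at h₁
  have h₂ := congrArg (fun u ↦ T b f (T a e u)) h₁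
  simp only [hT.sq a e hea.symm, hT.sq b f hfb.symm] at h₂
  exact h₂.symm

theorem card_le_finrank_add_one_of_not_eqOnDisjoint [DecidableEq α] [CharZero K]
    [FiniteDimensional K V] (hT : IsTranspositionSystem T) (hW : IsPairStable T S W)
    (hS : 4 ≤ S.card) (h : ¬ EqOnDisjoint T S W) : S.card ≤ finrank K W + 1 := by
  induction hn : S.card using Nat.strong_induction_on generalizing S W with
  | _ n ih =>
  subst hn
  by_contra! hlt
  unfold EqOnDisjoint at h
  push Not at h
  obtain ⟨a, ha, b, hb, c, hc, d, hd, hab, hcd, hca, hcb, hda, hdb, w, hw, hne⟩ := h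
  have hcard : ((S.erase a).erase b).card = S.card - 2 := by
    rw [Finset.card_erase_of_mem (Finset.mem_erase.2 ⟨hab.symm, hb⟩),
      Finset.card_erase_of_mem ha]
    omega
  have hneg := isPairStable_antiPart hT hW hab
  have hpos : IsPairStable T ((S.erase a).erase b) (antiPart (fun x y ↦ -T x y) W a b) := by
    simpa using isPairStable_neg (isPairStable_antiPart hT.neg (isPairStable_neg hW) hab)
  have adj_neg : ¬ EqOnAdjacent T ((S.erase a).erase b) (antiPart T W a b) := fun h' ↦
    hne (eqOn_of_eqOnAdjacent_antiPart hT hW hS hlt ha hb hc hd hab hcd hca hcb hda hdb h' hw)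
  have adj_pos :
      ¬ EqOnAdjacent T ((S.erase a).erase b) (antiPart (fun x y ↦ -T x y) W a b) := fun h' ↦
    hne (neg_injective (eqOn_of_eqOnAdjacent_antiPart hT.neg (isPairStable_neg hW) hS hlt ha hb
      hc hd hab hcd hca hcb hda hdb (eqOnAdjacent_neg_iff.2 h') hw))
  have three := three_le_card_of_not_eqOnAdjacent adj_neg
  have two_neg := two_le_finrank_of_not_eqOnAdjacent hT hneg adj_neg
  have two_pos := two_le_finrank_of_not_eqOnAdjacent hT hpos adj_pos
  have hsum := finrank_antiPart_add_le (T := T) (W := W) (a := a) (b := b)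
  have rec_neg (h₁ : ¬ EqOnDisjoint T ((S.erase a).erase b) (antiPart T W a b))
      (h₂ : 6 ≤ S.card) := ih _ (by omega) hneg (by omega) h₁ rfl
  have rec_pos
      (h₁ : ¬ EqOnDisjoint T ((S.erase a).erase b) (antiPart (fun x y ↦ -T x y) W a b))
      (h₂ : 6 ≤ S.card) := ih _ (by omega) hpos (by omega) h₁ rfl
  rw [hcard] at three rec_neg rec_pos
  rcases lt_trichotomy S.card 6 with h₆ | h₆ | h₆
  · omega
  · have disj_neg : EqOnDisjoint T ((S.erase a).erase b) (antiPart T W a b) := by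
      by_contra h₁
      have := rec_neg h₁ h₆.ge
      omega
    have disj_pos :
        EqOnDisjoint T ((S.erase a).erase b) (antiPart (fun x y ↦ -T x y) W a b) := by
      by_contra h₁
      have := rec_pos h₁ h₆.ge
      omega
    have hcm : c ∈ (S.erase a).erase b := by simp [*]
    have hdm : d ∈ (S.erase a).erase b := by simp [*]
    have hcard' : 1 < ((((S.erase a).erase b).erase c).erase d).card := by
      rw [Finset.card_erase_of_mem (Finset.mem_erase.2 ⟨hcd.symm, hdm⟩),
        Finset.card_erase_of_mem hcm]
      omega
    obtain ⟨e, he, f, hf, hef⟩ := Finset.one_lt_card.1 hcard'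
    rw [Finset.mem_erase, Finset.mem_erase] at he hf
    obtain ⟨hed, hec, hem⟩ := he
    obtain ⟨hfd, hfc, hfm⟩ := hf
    have he := hem
    have hf := hfm
    simp only [Finset.mem_erase] at he hf
    exact hne (eqOn_of_eqOn_disjoint hT hW ha hb he.2.2 hf.2.2 hab hcd hef hca hcb hda hdb
      he.2.1 hf.2.1 hf.1 hec hed hfc hfd
      (fun u hu ↦ eqOn_of_eqOn_antiPart hT hW ha hb hab
        (disj_neg c hcm d hdm e hem f hfm hcd hef hec hed hfc hfd)
        (disj_pos c hcm d hdm e hem f hfm hcd hef hec hed hfc hfd) hu) hw)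
  · have h₁ := rec_neg (fun h₁ ↦ adj_neg (eqOnAdjacent_of_eqOnDisjoint (by omega) h₁)) h₆.le
    have h₂ := rec_pos (fun h₁ ↦ adj_pos (eqOnAdjacent_of_eqOnDisjoint (by omega) h₁)) h₆.le
    omega

theorem of_monoidHom [DecidableEq α] (f : Equiv.Perm α →* End K V) :
    IsTranspositionSystem fun x y ↦ f (Equiv.swap x y) where
  symm x y := by rw [Equiv.swap_comm]
  sq x y _ v := by rw [← End.mul_apply, ← map_mul, Equiv.swap_mul_self, map_one, End.one_apply]
  braid x y z hxy hxz hyz v := by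
    simp only [← End.mul_apply, ← map_mul]
    congr 2
    rw [Equiv.mul_swap_eq_swap_mul, Equiv.swap_apply_left,
      Equiv.swap_apply_of_ne_of_ne hxz.symm hyz.symm]
  comm x y z w hxy hzw hxz hxw hyz hyw v := by
    simp only [← End.mul_apply, ← map_mul]
    congr 2
    rw [Equiv.mul_swap_eq_swap_mul, Equiv.swap_apply_of_ne_of_ne hxz.symm hyz.symm,
      Equiv.swap_apply_of_ne_of_ne hxw.symm hyw.symm]

end IsTranspositionSystem

/-- For `n ≥ 5`, if the symmetric group on `n` letters embeds into `GL(d, ℝ)`, then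
`d ≥ n - 1`. -/
theorem stmt_15 (n : ℕ) (hn : 5 ≤ n) (d : ℕ)
    (h : ∃ f : Equiv.Perm (Fin n) →* Matrix.GeneralLinearGroup (Fin d) ℝ,
      Function.Injective f) :
    n - 1 ≤ d := by
  obtain ⟨f, hf⟩ := h
  let e : Matrix (Fin d) (Fin d) ℝ ≃ₐ[ℝ] End ℝ (Fin d → ℝ) := Matrix.toLinAlgEquiv'
  let g : Equiv.Perm (Fin n) →* End ℝ (Fin d → ℝ) :=
    (e : Matrix (Fin d) (Fin d) ℝ →* End ℝ (Fin d → ℝ)).comp ((Units.coeHom _).comp f)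
  have hg : Function.Injective g := e.injective.comp (Units.val_injective.comp hf)
  have key := IsTranspositionSystem.card_le_finrank_add_one_of_not_eqOnDisjoint
    (IsTranspositionSystem.of_monoidHom g) (S := Finset.univ) (W := ⊤)
    (fun _ _ _ _ _ _ _ ↦ Submodule.mem_top) (by rw [Finset.card_fin]; omega) (fun h ↦ ?_)
  · rw [Finset.card_fin, finrank_top, finrank_fin_fun] at key
    omega
  · let x : Fin 4 → Fin n := Fin.castLE (by omega)
    have hx : ∀ i j, i ≠ j → x i ≠ x j := fun i j hij ↦
      (Fin.castLE_injective _).ne hij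
    have h₁ : Equiv.swap (x 0) (x 1) = Equiv.swap (x 2) (x 3) :=
      hg (LinearMap.ext fun w ↦ h (x 0) (Finset.mem_univ _) (x 1) (Finset.mem_univ _) (x 2)
        (Finset.mem_univ _) (x 3) (Finset.mem_univ _) (hx _ _ (by decide)) (hx _ _ (by decide))
        (hx _ _ (by decide)) (hx _ _ (by decide)) (hx _ _ (by decide)) (hx _ _ (by decide)) w
        Submodule.mem_top)
    have h₂ := congrArg (fun σ ↦ σ (x 0)) h₁
    simp only [Equiv.swap_apply_left] at h₂
    rw [Equiv.swap_apply_of_ne_of_ne (hx _ _ (by decide)) (hx _ _ (by decide))] at h₂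
    exact hx 1 0 (by decide) h₂
end

section
/- Let n, m be natural numbers with n ≥ 2 and m ≥ 2. Define the 4×4 real matrices A₁ = blockdiag(R(2π/n), I₂) and A₂ = blockdiag(R(2π/m), R(2π/m)), where I₂ is the 2×2 identity. Then there do not exist linear subspaces Z₁, Z₂ of ℝ⁴ with Z₁ + Z₂ = ℝ⁴ such that A₂ · v = v for all v ∈ Z₁ and A₁ · v = v for all v ∈ Z₂. -/
open Real

theorem cos_two_pi_div_ne_one {n : ℕ} (hn : 2 ≤ n) : cos (2 * π / n) ≠ 1 := by
  have hn' : (2 : ℝ) ≤ n := by exact_mod_cast hn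
  have hpos : 0 < 2 * π / n := by positivity
  have hlt : 2 * π / n < 2 * π := by
    rw [div_lt_iff₀ (by linarith)]
    nlinarith [pi_pos]
  intro h
  exact hpos.ne' ((cos_eq_one_iff_of_lt_of_lt (by linarith [pi_pos]) hlt).1 h)

theorem eq_zero_of_rotation_fixed {θ x y : ℝ} (hθ : cos θ ≠ 1)
    (hx : cos θ * x - sin θ * y = x) (hy : sin θ * x + cos θ * y = y) : x = 0 := by
  have h : (2 * (1 - cos θ)) * x = 0 := by
    linear_combination (cos θ - 1) * hx + sin θ * hy - x * sin_sq_add_cos_sq θ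
  have hne : 2 * (1 - cos θ) ≠ 0 := mul_ne_zero two_ne_zero (sub_ne_zero.2 hθ.symm)
  exact (mul_eq_zero.1 h).resolve_left hne

/-- Case 1 of Appendix F: with `A₁ = blockdiag(R(2π/n), I₂)` and
`A₂ = blockdiag(R(2π/m), R(2π/m))` (`n, m ≥ 2`), there are no subspaces `Z₁, Z₂` of `ℝ⁴`
spanning `ℝ⁴` such that `A₂` fixes `Z₁` pointwise and `A₁` fixes `Z₂` pointwise. -/
theorem stmt_16 (n m : ℕ) (hn : 2 ≤ n) (hm : 2 ≤ m)
    (A₁ A₂ : Matrix (Fin 4) (Fin 4) ℝ)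
    (hA₁ : A₁ = !![Real.cos (2 * π / n), -Real.sin (2 * π / n), 0, 0;
                   Real.sin (2 * π / n),  Real.cos (2 * π / n), 0, 0;
                   0, 0, 1, 0;
                   0, 0, 0, 1])
    (hA₂ : A₂ = !![Real.cos (2 * π / m), -Real.sin (2 * π / m), 0, 0;
                   Real.sin (2 * π / m),  Real.cos (2 * π / m), 0, 0;
                   0, 0, Real.cos (2 * π / m), -Real.sin (2 * π / m);
                   0, 0, Real.sin (2 * π / m),  Real.cos (2 * π / m)]) :
    ¬ ∃ Z₁ Z₂ : Submodule ℝ (Fin 4 → ℝ), Z₁ ⊔ Z₂ = ⊤ ∧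
      (∀ v ∈ Z₁, A₂.mulVec v = v) ∧ (∀ v ∈ Z₂, A₁.mulVec v = v) := by
  rintro ⟨Z₁, Z₂, hsup, h₁, h₂⟩
  obtain ⟨u, hu, v, hv, huv⟩ :=
    Submodule.mem_sup.1 (hsup ▸ Submodule.mem_top : (Pi.single 0 1 : Fin 4 → ℝ) ∈ Z₁ ⊔ Z₂)
  have hu0 : u 0 = 0 := by
    have h := h₁ u hu
    have hx := congrFun h 0
    have hy := congrFun h 1
    simp [hA₂, Matrix.mulVec, dotProduct, Fin.sum_univ_four] at hx hy
    exact eq_zero_of_rotation_fixed (cos_two_pi_div_ne_one hm) (by linarith) hy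
  have hv0 : v 0 = 0 := by
    have h := h₂ v hv
    have hx := congrFun h 0
    have hy := congrFun h 1
    simp [hA₁, Matrix.mulVec, dotProduct, Fin.sum_univ_four] at hx hy
    exact eq_zero_of_rotation_fixed (cos_two_pi_div_ne_one hn) (by linarith) hy
  have h := congrFun huv 0
  simp [hu0, hv0] at h
end
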